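/- Let T be a 2-tree on [n−1], suppose the Mandelstam invariants s are generic for T, and let x̂ ∈ U be a critical point of the scattering potential L_T. Then the square of the CHY integrand evaluated at x̂ satisfies I_T(x̂)² = Π_{triangles {i,j,k} of T, i<j<k} ([s_{{i,k}}] + [s_{{j,k}}])^{b_k+1} / ([s_{{i,k}}]^{a_{{i,k}}+1} · [s_{{j,k}}]^{a_{{j,k}}+1}). -/

import Mathlib

namespace MinKin

noncomputable section

attribute [local instance] Classical.propDecidable

open scoped BigOperators

/-- First row of the 2×n matrix X, at column `j` (1-based). -/
def colA (n j : ℕ) : ℂ := if j = n then 0 else 1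

/-- Second row of X at column `j` (1-based): `(0,1,x_1,…,x_{n-3},1)`. -/
def colB (n : ℕ) (x : Fin (n - 3) → ℂ) (j : ℕ) : ℂ :=
  if j = 1 then 0
  else if j = 2 then 1
  else if j = n then 1
  else if h : j - 3 < n - 3 then x ⟨j - 3, h⟩ else 0

/-- The Plücker coordinate `p_{ij}(x)`, the 2×2 minor of X on columns i and j. -/
def pc (n : ℕ) (x : Fin (n - 3) → ℂ) (i j : ℕ) : ℂ :=
  colA n i * colB n x j - colA n j * colB n x i

/-- The partial derivative `∂p_{ij}/∂x_m` (with `m : Fin (n-3)` zero-based, so that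
the variable `x m` appears in column `(m:ℕ)+3` of X). -/
def dpc (n : ℕ) (i j : ℕ) (m : Fin (n - 3)) : ℂ :=
  colA n i * (if j = (m : ℕ) + 3 then (1 : ℂ) else 0)
    - colA n j * (if i = (m : ℕ) + 3 then (1 : ℂ) else 0)

/-- The index set `S = {(i,j) : 1 ≤ i < j ≤ n-1, (i,j) ≠ (1,2)}`. -/
def Sfin (n : ℕ) : Finset (ℕ × ℕ) :=
  ((Finset.Icc 1 (n - 1)) ×ˢ (Finset.Icc 1 (n - 1))).filter
    (fun e => e.1 < e.2 ∧ e ≠ (1, 2))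

/-- The domain `U = {x : p_{ij}(x) ≠ 0 for all (i,j) ∈ S}`. -/
def Udom (n : ℕ) : Set (Fin (n - 3) → ℂ) :=
  {x | ∀ e ∈ Sfin n, pc n x e.1 e.2 ≠ 0}

/-- `x` is a critical point of `L_{T₀} = Σ_{e ∈ T₀} s_e · log p_e`. -/
def IsCrit (n : ℕ) (T₀ : Finset (ℕ × ℕ)) (s : ℕ × ℕ → ℂ) (x : Fin (n - 3) → ℂ) : Prop :=
  ∀ m : Fin (n - 3), ∑ e ∈ T₀, s e * dpc n e.1 e.2 m / pc n x e.1 e.2 = 0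

/-- Edge sets built inductively from the parent choices `par`. -/
def edgesUpTo (par : ℕ → ℕ × ℕ) : ℕ → Finset (ℕ × ℕ)
  | 0 => {(1, 2)}
  | k + 1 =>
      if k + 1 < 3 then {(1, 2)}
      else edgesUpTo par k ∪ {((par (k + 1)).1, k + 1), ((par (k + 1)).2, k + 1)}

/-- A 2-tree on `[n-1]`: for each `k = 3,…,n-1` an already-present edge
`par k = (i_k, j_k)` with `i_k < j_k ≤ k-1` is chosen, and the edges
`(i_k, k)` and `(j_k, k)` are added. -/
structure TwoTree (n : ℕ) : Type where
  par : ℕ → ℕ × ℕ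
  lt : ∀ k, 3 ≤ k → k ≤ n - 1 → (par k).1 < (par k).2 ∧ (par k).2 < k
  mem : ∀ k, 3 ≤ k → k ≤ n - 1 → par k ∈ edgesUpTo par (k - 1)

/-- The edge set of a 2-tree. -/
def TwoTree.edges {n : ℕ} (T : TwoTree n) : Finset (ℕ × ℕ) := edgesUpTo T.par (n - 1)

/-- A finite edge set is a 2-tree on `[n-1]`. -/
def IsTwoTree (n : ℕ) (E : Finset (ℕ × ℕ)) : Prop := ∃ T : TwoTree n, T.edges = E

/-- `c` is a child of `e` in the 2-tree `T`. -/
def Child (n : ℕ) (T : TwoTree n) (e c : ℕ × ℕ) : Prop :=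
  ∃ k, 3 ≤ k ∧ k ≤ n - 1 ∧ T.par k = e ∧ (c = (e.1, k) ∨ c = (e.2, k))

/-- The set `dec(e)` of descendants of the edge `e` (including `e` itself). -/
def dec (n : ℕ) (T : TwoTree n) (e : ℕ × ℕ) : Finset (ℕ × ℕ) :=
  T.edges.filter (fun f => Relation.ReflTransGen (Child n T) e f)

/-- The bracket `[s_e] = Σ_{f ∈ dec(e)} s_f`. -/
def brk (n : ℕ) (T : TwoTree n) (s : ℕ × ℕ → ℂ) (e : ℕ × ℕ) : ℂ :=
  ∑ f ∈ dec n T e, s f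

/-- The Mandelstam invariants `s` are generic for `T`. -/
def Generic (n : ℕ) (T : TwoTree n) (s : ℕ × ℕ → ℂ) : Prop :=
  ∀ k, 3 ≤ k → k ≤ n - 1 →
    brk n T s ((T.par k).1, k) ≠ 0 ∧ brk n T s ((T.par k).2, k) ≠ 0 ∧
      brk n T s ((T.par k).1, k) + brk n T s ((T.par k).2, k) ≠ 0

/-- `a_e = |dec(e)|`. -/
def aA (n : ℕ) (T : TwoTree n) (e : ℕ × ℕ) : ℕ := (dec n T e).card

/-- `v_T(e)`: the number of triangles of `T` containing the edge `e`. -/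
def vT (n : ℕ) (T : TwoTree n) (e : ℕ × ℕ) : ℕ :=
  ((Finset.Icc 3 (n - 1)).filter
    (fun k => e = T.par k ∨ e = ((T.par k).1, k) ∨ e = ((T.par k).2, k))).card

/-- The Horn product `P_e(s)`: over all ancestral triangles `{i,j,k}` of `e`, the
factor `[s_c]/([s_{(i,k)}]+[s_{(j,k)}])` where `c` is the child containing `e`
among its descendants. -/
def hornP (n : ℕ) (T : TwoTree n) (s : ℕ × ℕ → ℂ) (e : ℕ × ℕ) : ℂ :=
  ∏ k ∈ Finset.Icc 3 (n - 1),
    (if e ∈ dec n T ((T.par k).1, k) then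
        brk n T s ((T.par k).1, k)
          / (brk n T s ((T.par k).1, k) + brk n T s ((T.par k).2, k))
      else if e ∈ dec n T ((T.par k).2, k) then
        brk n T s ((T.par k).2, k)
          / (brk n T s ((T.par k).1, k) + brk n T s ((T.par k).2, k))
      else 1)

/-- Auxiliary recursion for the signs `ε_e`. -/
def epsAux (par : ℕ → ℕ × ℕ) : ℕ → ℕ × ℕ → ℂ
  | 0, _ => 1
  | k + 1, e =>
      if e = (1, 2) then 1
      else if e = ((par (k + 1)).1, k + 1) then epsAux par k (par (k + 1))
      else if e = ((par (k + 1)).2, k + 1) then -(epsAux par k (par (k + 1)))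
      else epsAux par k e

/-- The sign `ε_e ∈ {1,-1}`: `ε_{(1,2)} = 1`, `ε_{(i,k)} = ε_{(i,j)}`,
`ε_{(j,k)} = -ε_{(i,j)}` for each triangle `{i,j,k}`. -/
def eps (n : ℕ) (T : TwoTree n) (e : ℕ × ℕ) : ℂ := epsAux T.par (n - 1) e

/-- The negated Hessian matrix `𝓗(x) = -Hess(L_{T₀})(x)`. -/
def negHess (n : ℕ) (T₀ : Finset (ℕ × ℕ)) (s : ℕ × ℕ → ℂ) (x : Fin (n - 3) → ℂ) :
    Matrix (Fin (n - 3)) (Fin (n - 3)) ℂ :=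
  Matrix.of fun (l m : Fin (n - 3)) =>
    ∑ e ∈ T₀, s e * dpc n e.1 e.2 l * dpc n e.1 e.2 m / pc n x e.1 e.2 ^ 2

/-- The on-shell diagram of `T`: the triangles of `T` together with `(1,2,n)`. -/
def triples (n : ℕ) (T : TwoTree n) : Finset (ℕ × ℕ × ℕ) :=
  insert (1, 2, n) ((Finset.Icc 3 (n - 1)).image fun k => ((T.par k).1, (T.par k).2, k))

/-- The edge `e` is contained in the triple `t`. -/
def inTriple (e : ℕ × ℕ) (t : ℕ × ℕ × ℕ) : Prop :=
  e = (t.1, t.2.1) ∨ e = (t.1, t.2.2) ∨ e = (t.2.1, t.2.2)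

/-- `ṽ(e)`: the number of triples of the on-shell diagram containing `e`. -/
def vTil (n : ℕ) (T : TwoTree n) (e : ℕ × ℕ) : ℕ :=
  ((triples n T).filter (inTriple e)).card

/-- The edges contained in at least one triple of the on-shell diagram. -/
def diagEdges (n : ℕ) (T : TwoTree n) : Finset (ℕ × ℕ) :=
  (triples n T).biUnion fun t => {(t.1, t.2.1), (t.1, t.2.2), (t.2.1, t.2.2)}

/-- The CHY integrand `I_T(x) = Π_e p_e(x)^{ṽ(e)-2}`. -/
def integrand (n : ℕ) (T : TwoTree n) (x : Fin (n - 3) → ℂ) : ℂ :=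
  ∏ e ∈ diagEdges n T, pc n x e.1 e.2 ^ ((vTil n T e : ℤ) - 2)

/-- The Horn matrix `H_T`: rows come in consecutive triples indexed by the triangles
(in order k = 3,…,n-1), columns indexed by the non-initial edges of `T`
(in order (i_3,3),(j_3,3),(i_4,4),(j_4,4),…). -/
def HornMat (n : ℕ) (T : TwoTree n) : Matrix (Fin (3 * n - 9)) (Fin (2 * n - 6)) ℤ :=
  Matrix.of fun (ρ : Fin (3 * n - 9)) (c : Fin (2 * n - 6)) =>
    let k := (ρ : ℕ) / 3 + 3
    let c1 : ℕ × ℕ := ((T.par k).1, k)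
    let c2 : ℕ × ℕ := ((T.par k).2, k)
    let kc := (c : ℕ) / 2 + 3
    let e : ℕ × ℕ := if (c : ℕ) % 2 = 0 then ((T.par kc).1, kc) else ((T.par kc).2, kc)
    if (ρ : ℕ) % 3 = 0 then (if e ∈ dec n T c1 then 1 else 0)
    else if (ρ : ℕ) % 3 = 1 then (if e ∈ dec n T c2 then 1 else 0)
    else (if e ∈ dec n T c1 ∨ e ∈ dec n T c2 then -1 else 0)

/-- The matrix `A` whose r-th row has 1 in columns 3r-2, 3r-1, 3r (1-based). -/
def Amat (n : ℕ) : Matrix (Fin (n - 3)) (Fin (3 * n - 9)) ℤ :=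
  Matrix.of fun (r : Fin (n - 3)) (c : Fin (3 * n - 9)) =>
    if (c : ℕ) / 3 = (r : ℕ) then 1 else 0

/-- Polynomial version of the first row of X. -/
def colAP (n : ℕ) (j : ℕ) : MvPolynomial (Fin (n - 3)) ℂ := if j = n then 0 else 1

/-- Polynomial version of the second row of X. -/
def colBP (n : ℕ) (j : ℕ) : MvPolynomial (Fin (n - 3)) ℂ :=
  if j = 1 then 0
  else if j = 2 then 1
  else if j = n then 1
  else if h : j - 3 < n - 3 then MvPolynomial.X ⟨j - 3, h⟩ else 0

/-- The Plücker coordinate `p_{ij}` as a polynomial in `ℂ[x_1,…,x_{n-3}]`. -/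
def pcP (n : ℕ) (i j : ℕ) : MvPolynomial (Fin (n - 3)) ℂ :=
  colAP n i * colBP n j - colAP n j * colBP n i

/-- The r-th triple (0-based row index) of the on-shell diagram of `T`. -/
def tripleOf (n : ℕ) (T : TwoTree n) (r : ℕ) : ℕ × ℕ × ℕ :=
  if r + 3 ≤ n - 1 then ((T.par (r + 3)).1, (T.par (r + 3)).2, r + 3) else (1, 2, n)

/-- The matrix `M_T` over `ℂ[x_1,…,x_{n-3}]`, whose row indexed by a triple
`{i,j,k}` (i<j<k) is `p_{jk}·e_i - p_{ik}·e_j + p_{ij}·e_k`. -/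
def Mmat (n : ℕ) (T : TwoTree n) :
    Matrix (Fin (n - 2)) (Fin n) (MvPolynomial (Fin (n - 3)) ℂ) :=
  Matrix.of fun (r : Fin (n - 2)) (c : Fin n) =>
    if (c : ℕ) + 1 = (tripleOf n T r).1 then
      pcP n (tripleOf n T r).2.1 (tripleOf n T r).2.2
    else if (c : ℕ) + 1 = (tripleOf n T r).2.1 then
      -pcP n (tripleOf n T r).1 (tripleOf n T r).2.2
    else if (c : ℕ) + 1 = (tripleOf n T r).2.2 then
      pcP n (tripleOf n T r).1 (tripleOf n T r).2.1
    else 0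

/-- The matrix `M_T` evaluated at a point `x ∈ ℂ^{n-3}`. -/
def MmatC (n : ℕ) (T : TwoTree n) (x : Fin (n - 3) → ℂ) : Matrix (Fin (n - 2)) (Fin n) ℂ :=
  Matrix.of fun (r : Fin (n - 2)) (c : Fin n) =>
    if (c : ℕ) + 1 = (tripleOf n T r).1 then
      pc n x (tripleOf n T r).2.1 (tripleOf n T r).2.2
    else if (c : ℕ) + 1 = (tripleOf n T r).2.1 then
      -pc n x (tripleOf n T r).1 (tripleOf n T r).2.2
    else if (c : ℕ) + 1 = (tripleOf n T r).2.2 then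
      pc n x (tripleOf n T r).1 (tripleOf n T r).2.1
    else 0

/-- The 2×n matrix X evaluated at `x`. -/
def Xmat (n : ℕ) (x : Fin (n - 3) → ℂ) : Matrix (Fin 2) (Fin n) ℂ :=
  Matrix.of fun (r : Fin 2) (c : Fin n) =>
    if r = 0 then colA n ((c : ℕ) + 1) else colB n x ((c : ℕ) + 1)

/-- The monotone embedding `Fin (n-2) → Fin n` skipping the (0-based) positions
`a < b`. -/
def delCols (n a b : ℕ) (d : Fin (n - 2)) : Fin n :=
  ⟨if (d : ℕ) < a then (d : ℕ) else if (d : ℕ) + 1 < b then (d : ℕ) + 1 else (d : ℕ) + 2, by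
    have := d.isLt; split_ifs <;> omega⟩

/-- The maximal minor of `M_T` obtained by deleting columns `i < j` (1-based). -/
def maxMinor (n : ℕ) (T : TwoTree n) (i j : ℕ) : MvPolynomial (Fin (n - 3)) ℂ :=
  Matrix.det (Matrix.of fun (r d : Fin (n - 2)) => Mmat n T r (delCols n (i - 1) (j - 1) d))

/-- `Δ_T = Π_e p_e^{ṽ(e)-1}`. -/
def DeltaT (n : ℕ) (T : TwoTree n) : MvPolynomial (Fin (n - 3)) ℂ :=
  ∏ e ∈ diagEdges n T, pcP n e.1 e.2 ^ (vTil n T e - 1)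

/-- `T₀` has, for generic coefficients, exactly one critical point in `U`. -/
def UniqueCritGeneric (n : ℕ) (T₀ : Finset (ℕ × ℕ)) : Prop :=
  ∃ g : MvPolynomial {e : ℕ × ℕ // e ∈ T₀} ℂ, g ≠ 0 ∧
    ∀ s : ℕ × ℕ → ℂ, MvPolynomial.eval (fun v => s v.1) g ≠ 0 →
      ∃! x : Fin (n - 3) → ℂ, x ∈ Udom n ∧ IsCrit n T₀ s x

/-- `T₀ ⊆ S` exhibits minimal kinematics. -/
def ExhibitsMinKin (n : ℕ) (T₀ : Finset (ℕ × ℕ)) : Prop :=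
  T₀ ⊆ Sfin n ∧ UniqueCritGeneric n T₀ ∧
    ∀ T₁ : Finset (ℕ × ℕ), T₁ ⊆ Sfin n → T₀ ⊆ T₁ → UniqueCritGeneric n T₁ → T₁ = T₀

section TwoTreeEdges

variable {n : ℕ}

theorem edgesUpTo_succ (par : ℕ → ℕ × ℕ) {k : ℕ} (hk : 3 ≤ k + 1) :
    edgesUpTo par (k + 1) =
      edgesUpTo par k ∪ {((par (k + 1)).1, k + 1), ((par (k + 1)).2, k + 1)} := by
  rw [edgesUpTo, if_neg (by omega)]

theorem edgesUpTo_of_lt_three (par : ℕ → ℕ × ℕ) {k : ℕ} (hk : k < 3) :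
    edgesUpTo par k = {(1, 2)} := by
  cases k with
  | zero => rfl
  | succ k => rw [edgesUpTo, if_pos hk]

theorem mem_edgesUpTo {par : ℕ → ℕ × ℕ} {K : ℕ} {e : ℕ × ℕ} :
    e ∈ edgesUpTo par K ↔
      e = (1, 2) ∨ ∃ k, 3 ≤ k ∧ k ≤ K ∧ (e = ((par k).1, k) ∨ e = ((par k).2, k)) := by
  induction K with
  | zero =>
    simp only [edgesUpTo, Finset.mem_singleton]
    exact ⟨Or.inl, fun h => h.elim id fun ⟨k, h3, h0, _⟩ => by omega⟩
  | succ K ih =>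
    rcases lt_or_ge (K + 1) 3 with hK | hK
    · rw [edgesUpTo_of_lt_three par hK, Finset.mem_singleton]
      exact ⟨Or.inl, fun h => h.elim id fun ⟨k, h3, h0, _⟩ => by omega⟩
    · rw [edgesUpTo_succ par hK, Finset.mem_union, ih, Finset.mem_insert, Finset.mem_singleton]
      constructor
      · rintro ((h | ⟨k, h3, hk, h⟩) | h)
        · exact Or.inl h
        · exact Or.inr ⟨k, h3, by omega, h⟩
        · exact Or.inr ⟨K + 1, hK, le_rfl, h⟩
      · rintro (h | ⟨k, h3, hk, h⟩)
        · exact Or.inl (Or.inl h)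
        · rcases Nat.lt_or_ge K k with hlt | hle
          · obtain rfl : k = K + 1 := by omega
            exact Or.inr h
          · exact Or.inl (Or.inr ⟨k, h3, hle, h⟩)

theorem edgesUpTo_mono (par : ℕ → ℕ × ℕ) {K L : ℕ} (h : K ≤ L) :
    edgesUpTo par K ⊆ edgesUpTo par L := by
  intro e he
  rw [mem_edgesUpTo] at he ⊢
  exact he.imp_right fun ⟨k, h3, hk, h'⟩ => ⟨k, h3, hk.trans h, h'⟩

theorem TwoTree.mem_edges {T : TwoTree n} {e : ℕ × ℕ} :
    e ∈ T.edges ↔ e = (1, 2) ∨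
      ∃ k, 3 ≤ k ∧ k ≤ n - 1 ∧ (e = ((T.par k).1, k) ∨ e = ((T.par k).2, k)) :=
  mem_edgesUpTo

theorem TwoTree.par_mem (T : TwoTree n) {k : ℕ} (h3 : 3 ≤ k) (hk : k ≤ n - 1) :
    T.par k ∈ T.edges :=
  edgesUpTo_mono T.par (by omega) (T.mem k h3 hk)

theorem TwoTree.fst_mem (T : TwoTree n) {k : ℕ} (h3 : 3 ≤ k) (hk : k ≤ n - 1) :
    ((T.par k).1, k) ∈ T.edges :=
  T.mem_edges.2 (Or.inr ⟨k, h3, hk, Or.inl rfl⟩)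

theorem TwoTree.snd_mem (T : TwoTree n) {k : ℕ} (h3 : 3 ≤ k) (hk : k ≤ n - 1) :
    ((T.par k).2, k) ∈ T.edges :=
  T.mem_edges.2 (Or.inr ⟨k, h3, hk, Or.inr rfl⟩)

theorem TwoTree.edge_bounds (hn : 4 ≤ n) (T : TwoTree n) :
    ∀ {e : ℕ × ℕ}, e ∈ T.edges → 1 ≤ e.1 ∧ e.1 < e.2 ∧ e.2 ≤ n - 1 := by
  suffices h : ∀ N, ∀ e ∈ T.edges, e.2 = N → 1 ≤ e.1 ∧ e.1 < e.2 ∧ e.2 ≤ n - 1 from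
    fun {e} he => h e.2 e he rfl
  intro N
  induction N using Nat.strong_induction_on with
  | _ N ih =>
    rintro e he rfl
    rcases T.mem_edges.1 he with rfl | ⟨k, h3, hk, h⟩
    · exact ⟨le_rfl, by norm_num, by simp only; omega⟩
    · have hlt := T.lt k h3 hk
      have hp := ih (T.par k).2 (by rcases h with rfl | rfl <;> exact hlt.2) _
        (T.par_mem h3 hk) rfl
      rcases h with rfl | rfl <;> refine ⟨?_, ?_, hk⟩ <;> simp only <;> omega

@[to_additive]
theorem prod_edgesUpTo {M : Type*} [CommMonoid M] (T : TwoTree n) (h : ℕ × ℕ → M) {K : ℕ}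
    (hK : K ≤ n - 1) :
    ∏ e ∈ edgesUpTo T.par K, h e =
      h (1, 2) * ∏ k ∈ Finset.Icc 3 K, (h ((T.par k).1, k) * h ((T.par k).2, k)) := by
  induction K with
  | zero => simp [edgesUpTo]
  | succ K ih =>
    rcases lt_or_ge (K + 1) 3 with hK3 | hK3
    · rw [edgesUpTo_of_lt_three _ hK3, Finset.Icc_eq_empty (by omega)]
      simp
    · have hlt := T.lt (K + 1) hK3 hK
      have hne : ((T.par (K + 1)).1, K + 1) ≠ ((T.par (K + 1)).2, K + 1) := by
        intro h'
        have := congrArg Prod.fst h'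
        simp only at this
        omega
      have hdisj : Disjoint (edgesUpTo T.par K)
          {((T.par (K + 1)).1, K + 1), ((T.par (K + 1)).2, K + 1)} := by
        rw [Finset.disjoint_left]
        intro e he he'
        have h2 : e.2 = K + 1 := by
          rw [Finset.mem_insert, Finset.mem_singleton] at he'
          rcases he' with rfl | rfl <;> rfl
        rcases mem_edgesUpTo.1 he with rfl | ⟨k, _, hk, rfl | rfl⟩ <;> simp only at h2 <;> omega
      rw [edgesUpTo_succ _ hK3, Finset.prod_union hdisj, ih (by omega), Finset.prod_pair hne,
        ← Finset.insert_Icc_right_eq_Icc_add_one (by omega), Finset.prod_insert (by simp)]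
      rw [mul_assoc, mul_comm (∏ k ∈ Finset.Icc 3 K, _)]

@[to_additive]
theorem TwoTree.prod_edges {M : Type*} [CommMonoid M] (T : TwoTree n) (h : ℕ × ℕ → M) :
    ∏ e ∈ T.edges, h e =
      h (1, 2) * ∏ k ∈ Finset.Icc 3 (n - 1), (h ((T.par k).1, k) * h ((T.par k).2, k)) :=
  prod_edgesUpTo T h le_rfl

@[to_additive]
theorem TwoTree.prod_edges_fiberwise {M : Type*} [CommMonoid M] (T : TwoTree n) (h : ℕ → M) :
    ∏ e ∈ T.edges, ∏ k ∈ (Finset.Icc 3 (n - 1)).filter (fun k => T.par k = e), h k =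
      ∏ k ∈ Finset.Icc 3 (n - 1), h k :=
  Finset.prod_fiberwise_of_maps_to
    (fun _ hk => T.par_mem (Finset.mem_Icc.1 hk).1 (Finset.mem_Icc.1 hk).2) h

end TwoTreeEdges

section Descendants

variable {n : ℕ} {T : TwoTree n}

theorem Child.snd_lt {e c : ℕ × ℕ} (h : Child n T e c) : e.2 < c.2 := by
  obtain ⟨k, h3, hk, rfl, rfl | rfl⟩ := h <;> exact (T.lt k h3 hk).2

theorem Child.mem_edges {e c : ℕ × ℕ} (h : Child n T e c) : c ∈ T.edges := by
  obtain ⟨k, h3, hk, rfl, h⟩ := h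
  exact T.mem_edges.2 (Or.inr ⟨k, h3, hk, h⟩)

theorem Child.par_eq {e c : ℕ × ℕ} (h : Child n T e c) : T.par c.2 = e := by
  obtain ⟨k, h3, hk, rfl, rfl | rfl⟩ := h <;> rfl

theorem snd_le_of_reflTransGen_child {e f : ℕ × ℕ}
    (h : Relation.ReflTransGen (Child n T) e f) : e.2 ≤ f.2 := by
  induction h with
  | refl => exact le_rfl
  | tail _ h ih => exact ih.trans h.snd_lt.le

theorem reflTransGen_child_total {c c' f : ℕ × ℕ} (h : Relation.ReflTransGen (Child n T) c f)
    (h' : Relation.ReflTransGen (Child n T) c' f) :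
    Relation.ReflTransGen (Child n T) c c' ∨ Relation.ReflTransGen (Child n T) c' c := by
  have hu : Relator.RightUnique (Function.swap (Child n T)) := fun a b d hb hd =>
    Child.par_eq hb ▸ Child.par_eq hd
  rcases Relation.ReflTransGen.total_of_right_unique hu (Relation.reflTransGen_swap.2 h)
    (Relation.reflTransGen_swap.2 h') with h | h
  · exact Or.inr (Relation.reflTransGen_swap.1 h)
  · exact Or.inl (Relation.reflTransGen_swap.1 h)

theorem Child.eq_of_reflTransGen {e c c' : ℕ × ℕ} (hc : Child n T e c) (hc' : Child n T e c')
    (h : Relation.ReflTransGen (Child n T) c c') : c = c' := by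
  rcases Relation.ReflTransGen.cases_tail h with h | ⟨d, hd, hdc⟩
  · exact h.symm
  · have h1 := snd_le_of_reflTransGen_child hd
    rw [← hdc.par_eq, hc'.par_eq] at h1
    exact absurd hc.snd_lt h1.not_gt

theorem dec_eq {e : ℕ × ℕ} (he : e ∈ T.edges) :
    dec n T e = insert e ((T.edges.filter (Child n T e)).biUnion (dec n T)) := by
  ext f
  simp only [dec, Finset.mem_filter, Finset.mem_insert, Finset.mem_biUnion]
  constructor
  · rintro ⟨hf, h⟩
    rcases Relation.ReflTransGen.cases_head h with rfl | ⟨c, hc, hcf⟩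
    · exact Or.inl rfl
    · exact Or.inr ⟨c, ⟨hc.mem_edges, hc⟩, hf, hcf⟩
  · rintro (rfl | ⟨c, ⟨_, hc⟩, hf, hcf⟩)
    · exact ⟨he, .refl⟩
    · exact ⟨hf, .head hc hcf⟩

theorem sum_dec {M : Type*} [AddCommMonoid M] (hn : 4 ≤ n) (g : ℕ × ℕ → M) {e : ℕ × ℕ}
    (he : e ∈ T.edges) :
    ∑ f ∈ dec n T e, g f =
      g e + ∑ k ∈ (Finset.Icc 3 (n - 1)).filter (fun k => T.par k = e),
        (∑ f ∈ dec n T ((T.par k).1, k), g f + ∑ f ∈ dec n T ((T.par k).2, k), g f) := by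
  have hnot : e ∉ (T.edges.filter (Child n T e)).biUnion (dec n T) := by
    simp only [dec, Finset.mem_filter, Finset.mem_biUnion]
    rintro ⟨c, ⟨_, hc⟩, _, hce⟩
    exact absurd hc.snd_lt (snd_le_of_reflTransGen_child hce).not_gt
  have hdisj : ((T.edges.filter (Child n T e) : Finset (ℕ × ℕ)) : Set (ℕ × ℕ)).PairwiseDisjoint
      (dec n T) := by
    intro c hc c' hc' hne
    rw [Finset.mem_coe, Finset.mem_filter] at hc hc'
    refine Finset.disjoint_left.2 fun f hf hf' => hne ?_
    rw [dec, Finset.mem_filter] at hf hf'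
    rcases reflTransGen_child_total hf.2 hf'.2 with h | h
    · exact hc.2.eq_of_reflTransGen hc'.2 h
    · exact (hc'.2.eq_of_reflTransGen hc.2 h).symm
  rw [dec_eq he, Finset.sum_insert hnot, Finset.sum_biUnion hdisj, Finset.sum_filter,
    T.sum_edges, Finset.sum_filter, if_neg, zero_add]
  · congr 1
    refine Finset.sum_congr rfl fun k hk => ?_
    rw [Finset.mem_Icc] at hk
    by_cases h : T.par k = e
    · rw [if_pos h, if_pos ⟨k, hk.1, hk.2, h, Or.inl (by rw [h])⟩,
        if_pos ⟨k, hk.1, hk.2, h, Or.inr (by rw [h])⟩]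
    · rw [if_neg h, if_neg fun hc => h hc.par_eq, if_neg fun hc => h hc.par_eq, add_zero]
  · intro hc
    have hb := T.edge_bounds hn he
    have := hc.snd_lt
    simp only at this
    omega

theorem brk_eq (hn : 4 ≤ n) (s : ℕ × ℕ → ℂ) {e : ℕ × ℕ} (he : e ∈ T.edges) :
    brk n T s e = s e + ∑ k ∈ (Finset.Icc 3 (n - 1)).filter (fun k => T.par k = e),
      (brk n T s ((T.par k).1, k) + brk n T s ((T.par k).2, k)) :=
  sum_dec hn s he

theorem aA_eq (hn : 4 ≤ n) {e : ℕ × ℕ} (he : e ∈ T.edges) :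
    aA n T e = 1 + ∑ k ∈ (Finset.Icc 3 (n - 1)).filter (fun k => T.par k = e),
      (aA n T ((T.par k).1, k) + aA n T ((T.par k).2, k)) := by
  simpa only [aA, Finset.card_eq_sum_ones] using sum_dec hn (fun _ => 1) he

theorem odd_aA (hn : 4 ≤ n) : ∀ {e : ℕ × ℕ}, e ∈ T.edges → Odd (aA n T e) := by
  suffices h : ∀ N, ∀ e ∈ T.edges, n - e.2 = N → Odd (aA n T e) from
    fun {e} he => h (n - e.2) e he rfl
  intro N
  induction N using Nat.strong_induction_on with
  | _ N ih =>
    rintro e he rfl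
    rw [aA_eq hn he, add_comm]
    refine Even.add_one (Finset.even_sum _ fun k hk => ?_)
    simp only [Finset.mem_filter, Finset.mem_Icc] at hk
    obtain ⟨⟨h3, hk⟩, rfl⟩ := hk
    have hlt := T.lt k h3 hk
    exact (ih (n - k) (by omega) _ (T.fst_mem h3 hk) rfl).add_odd
      (ih (n - k) (by omega) _ (T.snd_mem h3 hk) rfl)

end Descendants

section Plucker

variable {n : ℕ} {x : Fin (n - 3) → ℂ}

theorem pc_of_lt {i j : ℕ} (hi : i < n) (hj : j < n) :
    pc n x i j = colB n x j - colB n x i := by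
  simp [pc, colA, hi.ne, hj.ne]

theorem dpc_of_lt {i j : ℕ} (hi : i < n) (hj : j < n) (m : Fin (n - 3)) :
    dpc n i j m = (if j = (m : ℕ) + 3 then 1 else 0) - (if i = (m : ℕ) + 3 then 1 else 0) := by
  simp [dpc, colA, hi.ne, hj.ne]

theorem pc_one_two (hn : 4 ≤ n) : pc n x 1 2 = 1 := by
  rw [pc_of_lt (by omega) (by omega)]
  simp [colB]

theorem pc_one_last (hn : 4 ≤ n) : pc n x 1 n = 1 := by
  have h1 : n ≠ 1 := by omega
  have h2 : n ≠ 2 := by omega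
  simp [pc, colA, colB, h1, h2, h1.symm]

theorem pc_two_last (hn : 4 ≤ n) : pc n x 2 n = 1 := by
  have h1 : n ≠ 1 := by omega
  have h2 : n ≠ 2 := by omega
  simp [pc, colA, colB, h1, h2, h2.symm]

theorem TwoTree.pc_ne_zero (hn : 4 ≤ n) (T : TwoTree n) (hx : x ∈ Udom n) {e : ℕ × ℕ}
    (he : e ∈ T.edges) : pc n x e.1 e.2 ≠ 0 := by
  by_cases h : e = (1, 2)
  · rw [h, pc_one_two hn]
    exact one_ne_zero
  · have hb := T.edge_bounds hn he
    refine hx e ?_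
    simp only [Sfin, Finset.mem_filter, Finset.mem_product, Finset.mem_Icc]
    exact ⟨⟨⟨by omega, by omega⟩, by omega, by omega⟩, hb.2.1, h⟩

end Plucker

section CriticalPoint

variable {n : ℕ} {T : TwoTree n} {s : ℕ × ℕ → ℂ} {x : Fin (n - 3) → ℂ}

theorem dpc_one_two (hn : 4 ≤ n) (m : Fin (n - 3)) : dpc n 1 2 m = 0 := by
  rw [dpc_of_lt (by omega) (by omega), if_neg (by omega), if_neg (by omega), sub_zero]

/-- The contribution of the triangle `{i,j,k}` to the `m`-th critical equation, after the
invariants have been rewritten in terms of the brackets. -/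
def triangleEq (n : ℕ) (T : TwoTree n) (s : ℕ × ℕ → ℂ) (x : Fin (n - 3) → ℂ) (k : ℕ)
    (m : Fin (n - 3)) : ℂ :=
  brk n T s ((T.par k).1, k) * (dpc n (T.par k).1 k m / pc n x (T.par k).1 k) +
    brk n T s ((T.par k).2, k) * (dpc n (T.par k).2 k m / pc n x (T.par k).2 k) -
      (brk n T s ((T.par k).1, k) + brk n T s ((T.par k).2, k)) *
        (dpc n (T.par k).1 (T.par k).2 m / pc n x (T.par k).1 (T.par k).2)

theorem sum_triangleEq (hn : 4 ≤ n) (hc : IsCrit n (T.edges.erase (1, 2)) s x)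
    (m : Fin (n - 3)) : ∑ k ∈ Finset.Icc 3 (n - 1), triangleEq n T s x k m = 0 := by
  set q : ℕ × ℕ → ℂ := fun e => dpc n e.1 e.2 m / pc n x e.1 e.2 with hq
  have hq0 : q (1, 2) = 0 := by simp only [hq, dpc_one_two hn, zero_div]
  have hcrit : ∑ e ∈ T.edges, s e * q e = 0 := by
    rw [← Finset.add_sum_erase _ _ (T.mem_edges.2 (Or.inl rfl)), hq0, mul_zero, zero_add,
      ← hc m]
    exact Finset.sum_congr rfl fun e _ => (mul_div_assoc _ _ _).symm
  have hbrk := T.sum_edges fun e => brk n T s e * q e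
  rw [hq0, mul_zero, zero_add] at hbrk
  have hsub : ∑ e ∈ T.edges, brk n T s e * q e =
      ∑ k ∈ Finset.Icc 3 (n - 1),
        (brk n T s ((T.par k).1, k) + brk n T s ((T.par k).2, k)) * q (T.par k) := by
    rw [← T.sum_edges_fiberwise, ← zero_add (∑ e ∈ T.edges, ∑ k ∈ _, _), ← hcrit,
      ← Finset.sum_add_distrib]
    refine Finset.sum_congr rfl fun e he => ?_
    rw [brk_eq hn s he, add_mul, Finset.sum_mul]
    congr 1
    refine Finset.sum_congr rfl fun k hk => ?_
    rw [(Finset.mem_filter.1 hk).2]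
  simp only [triangleEq, Finset.sum_sub_distrib]
  rw [← hsub, ← hbrk, sub_self]

theorem triangleEq_eq (hn : 4 ≤ n) (hx : x ∈ Udom n) {k : ℕ} (h3 : 3 ≤ k) (hk : k ≤ n - 1)
    (m : Fin (n - 3)) :
    triangleEq n T s x k m =
      (brk n T s ((T.par k).1, k) / pc n x (T.par k).1 k +
          brk n T s ((T.par k).2, k) / pc n x (T.par k).2 k) *
        ((if k = (m : ℕ) + 3 then 1 else 0) -
          (pc n x (T.par k).1 k * (if (T.par k).2 = (m : ℕ) + 3 then 1 else 0) -
              pc n x (T.par k).2 k * (if (T.par k).1 = (m : ℕ) + 3 then 1 else 0)) /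
            pc n x (T.par k).1 (T.par k).2) := by
  have hlt := T.lt k h3 hk
  have hp := T.pc_ne_zero hn hx (T.par_mem h3 hk)
  have hi := T.pc_ne_zero hn hx (T.fst_mem h3 hk)
  have hj := T.pc_ne_zero hn hx (T.snd_mem h3 hk)
  have hrel : pc n x (T.par k).1 (T.par k).2 = pc n x (T.par k).1 k - pc n x (T.par k).2 k := by
    rw [pc_of_lt (by omega) (by omega), pc_of_lt (by omega) (by omega),
      pc_of_lt (by omega) (by omega)]
    ring
  rw [triangleEq, dpc_of_lt (by omega) (by omega), dpc_of_lt (by omega) (by omega),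
    dpc_of_lt (by omega) (by omega)]
  simp only at hi hj
  rw [hrel] at hp ⊢
  field_simp
  ring

theorem triangle_critical (hn : 4 ≤ n) (hx : x ∈ Udom n)
    (hc : IsCrit n (T.edges.erase (1, 2)) s x) :
    ∀ {k : ℕ}, 3 ≤ k → k ≤ n - 1 →
      brk n T s ((T.par k).1, k) / pc n x (T.par k).1 k +
        brk n T s ((T.par k).2, k) / pc n x (T.par k).2 k = 0 := by
  suffices h : ∀ N k, 3 ≤ k → k ≤ n - 1 → n - k = N →
      brk n T s ((T.par k).1, k) / pc n x (T.par k).1 k +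
        brk n T s ((T.par k).2, k) / pc n x (T.par k).2 k = 0 from
    fun {k} h3 hk => h (n - k) k h3 hk rfl
  intro N
  induction N using Nat.strong_induction_on with
  | _ N ih =>
    rintro k h3 hk rfl
    have hsum := sum_triangleEq hn hc ⟨k - 3, by omega⟩
    have hval : k - 3 + 3 = k := by omega
    rw [Finset.sum_eq_single_of_mem k (Finset.mem_Icc.2 ⟨h3, hk⟩)] at hsum
    · have hlt := T.lt k h3 hk
      rw [triangleEq_eq hn hx h3 hk] at hsum
      simp only [hval] at hsum
      rwa [if_pos trivial, if_neg (by omega), if_neg (by omega), mul_zero, mul_zero, sub_zero,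
        zero_div, sub_zero, mul_one] at hsum
    · intro l hl hne
      rw [Finset.mem_Icc] at hl
      have hlt := T.lt l hl.1 hl.2
      rw [triangleEq_eq hn hx hl.1 hl.2]
      simp only [hval]
      rcases lt_or_gt_of_ne hne with h | h
      · rw [if_neg (by omega), if_neg (by omega), if_neg (by omega)]
        simp
      · rw [ih (n - l) (by omega) l hl.1 hl.2 rfl, zero_mul]

/-- At a critical point, the Plücker coordinates of a triangle are proportional to the brackets. -/
theorem exists_brk_eq_mul (hn : 4 ≤ n) (hx : x ∈ Udom n) (hs : Generic n T s)
    (hc : IsCrit n (T.edges.erase (1, 2)) s x) {k : ℕ} (h3 : 3 ≤ k) (hk : k ≤ n - 1) :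
    ∃ c : ℂ, c ≠ 0 ∧ brk n T s ((T.par k).1, k) = c * pc n x (T.par k).1 k ∧
      brk n T s ((T.par k).2, k) = -c * pc n x (T.par k).2 k ∧
      brk n T s ((T.par k).1, k) + brk n T s ((T.par k).2, k) =
        c * pc n x (T.par k).1 (T.par k).2 := by
  have hlt := T.lt k h3 hk
  have hi : pc n x (T.par k).1 k ≠ 0 := T.pc_ne_zero hn hx (T.fst_mem h3 hk)
  have hj : pc n x (T.par k).2 k ≠ 0 := T.pc_ne_zero hn hx (T.snd_mem h3 hk)
  have hA : brk n T s ((T.par k).1, k) =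
      brk n T s ((T.par k).1, k) / pc n x (T.par k).1 k * pc n x (T.par k).1 k :=
    (div_mul_cancel₀ _ hi).symm
  have hB : brk n T s ((T.par k).2, k) =
      -(brk n T s ((T.par k).1, k) / pc n x (T.par k).1 k) * pc n x (T.par k).2 k := by
    rw [eq_neg_of_add_eq_zero_left (triangle_critical hn hx hc h3 hk), neg_neg,
      div_mul_cancel₀ _ hj]
  refine ⟨_, div_ne_zero (hs k h3 hk).1 hi, hA, hB, ?_⟩
  rw [hB, pc_of_lt (i := (T.par k).1) (j := (T.par k).2) (by omega) (by omega)]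
  nth_rewrite 1 [hA]
  rw [pc_of_lt (i := (T.par k).2) (by omega) (by omega)]
  nth_rewrite 2 [pc_of_lt (by omega) (by omega)]
  ring

end CriticalPoint

section Integrand

variable {n : ℕ} {T : TwoTree n} {x : Fin (n - 3) → ℂ}

theorem diagEdges_eq : diagEdges n T = insert (1, n) (insert (2, n) T.edges) := by
  ext e
  simp only [diagEdges, triples, Finset.mem_biUnion, Finset.mem_insert, Finset.mem_image,
    Finset.mem_Icc, Finset.mem_singleton]
  constructor
  · rintro ⟨t, rfl | ⟨k, ⟨h3, hk⟩, rfl⟩, rfl | rfl | rfl⟩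
    · exact Or.inr (Or.inr (T.mem_edges.2 (Or.inl rfl)))
    · exact Or.inl rfl
    · exact Or.inr (Or.inl rfl)
    · exact Or.inr (Or.inr (T.par_mem h3 hk))
    · exact Or.inr (Or.inr (T.fst_mem h3 hk))
    · exact Or.inr (Or.inr (T.snd_mem h3 hk))
  · rintro (rfl | rfl | he)
    · exact ⟨_, Or.inl rfl, Or.inr (Or.inl rfl)⟩
    · exact ⟨_, Or.inl rfl, Or.inr (Or.inr rfl)⟩
    · rcases T.mem_edges.1 he with rfl | ⟨k, h3, hk, h⟩
      · exact ⟨_, Or.inl rfl, Or.inl rfl⟩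
      · exact ⟨_, Or.inr ⟨k, ⟨h3, hk⟩, rfl⟩, Or.inr h⟩

theorem prod_diagEdges (hn : 4 ≤ n) {M : Type*} [CommMonoid M] (h : ℕ × ℕ → M) :
    ∏ e ∈ diagEdges n T, h e = h (1, n) * (h (2, n) * ∏ e ∈ T.edges, h e) := by
  have hlast : ∀ i, (i, n) ∉ T.edges := fun i hi => by
    have := (T.edge_bounds hn hi).2.2
    simp only at this
    omega
  rw [diagEdges_eq, Finset.prod_insert, Finset.prod_insert (hlast 2)]
  rw [Finset.mem_insert, not_or]
  exact ⟨fun h => absurd (congrArg Prod.fst h) (by norm_num), hlast 1⟩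

theorem prod_pow_vTil (hn : 4 ≤ n) {M : Type*} [CommMonoid M] (h : ℕ × ℕ → M) :
    ∏ e ∈ diagEdges n T, h e ^ vTil n T e =
      h (1, 2) * h (1, n) * h (2, n) * ∏ k ∈ Finset.Icc 3 (n - 1),
        (h (T.par k) * h ((T.par k).1, k) * h ((T.par k).2, k)) := by
  have hedge : ∀ t ∈ triples n T, t.1 < t.2.1 ∧ t.2.1 < t.2.2 := by
    intro t ht
    rw [triples, Finset.mem_insert, Finset.mem_image] at ht
    rcases ht with rfl | ⟨k, hk, rfl⟩
    · exact ⟨by norm_num, by simp only; omega⟩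
    · rw [Finset.mem_Icc] at hk
      exact T.lt k hk.1 hk.2
  have htriple : ∀ t ∈ triples n T, ∏ e ∈ (diagEdges n T).filter (fun e => inTriple e t), h e =
      h (t.1, t.2.1) * h (t.1, t.2.2) * h (t.2.1, t.2.2) := by
    intro t ht
    have hlt := hedge t ht
    have hset : (diagEdges n T).filter (fun e => inTriple e t) =
        {(t.1, t.2.1), (t.1, t.2.2), (t.2.1, t.2.2)} := by
      ext e
      rw [Finset.mem_filter, Finset.mem_insert, Finset.mem_insert, Finset.mem_singleton]
      refine ⟨fun h => h.2, fun h => ⟨Finset.mem_biUnion.2 ⟨t, ht, ?_⟩, h⟩⟩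
      simpa only [Finset.mem_insert, Finset.mem_singleton, inTriple] using h
    rw [hset, Finset.prod_insert, Finset.prod_pair, mul_assoc]
    · simp only [ne_eq, Prod.mk.injEq]; omega
    · simp only [Finset.mem_insert, Finset.mem_singleton, Prod.mk.injEq]; omega
  have hpow : ∀ e ∈ diagEdges n T, h e ^ vTil n T e =
      ∏ t ∈ triples n T, if inTriple e t then h e else 1 := fun e _ => by
    rw [← Finset.prod_filter, Finset.prod_const, vTil]
  rw [Finset.prod_congr rfl hpow, Finset.prod_comm]
  simp only [← Finset.prod_filter]
  rw [Finset.prod_congr rfl htriple, triples, Finset.prod_insert, Finset.prod_image]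
  · exact fun k _ l _ hkl => congrArg (fun t : ℕ × ℕ × ℕ => t.2.2) hkl
  · rw [Finset.mem_image]
    rintro ⟨k, hk, h⟩
    rw [Finset.mem_Icc] at hk
    have := congrArg (fun t : ℕ × ℕ × ℕ => t.2.2) h
    simp only at this
    omega

theorem integrand_eq (hn : 4 ≤ n) (hx : x ∈ Udom n) :
    integrand n T x = ∏ k ∈ Finset.Icc 3 (n - 1),
      (pc n x (T.par k).1 (T.par k).2 / (pc n x (T.par k).1 k * pc n x (T.par k).2 k)) := by
  have hne : ∀ e ∈ diagEdges n T, pc n x e.1 e.2 ≠ 0 := by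
    intro e he
    rw [diagEdges_eq, Finset.mem_insert, Finset.mem_insert] at he
    rcases he with rfl | rfl | he
    · rw [pc_one_last hn]; exact one_ne_zero
    · rw [pc_two_last hn]; exact one_ne_zero
    · exact T.pc_ne_zero hn hx he
  have hsplit : integrand n T x = (∏ e ∈ diagEdges n T, pc n x e.1 e.2 ^ vTil n T e) /
      ∏ e ∈ diagEdges n T, pc n x e.1 e.2 ^ 2 := by
    rw [integrand, ← Finset.prod_div_distrib]
    refine Finset.prod_congr rfl fun e he => ?_
    rw [zpow_sub₀ (hne e he), zpow_natCast]
    norm_cast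
  rw [hsplit, prod_pow_vTil hn fun e => pc n x e.1 e.2,
    prod_diagEdges hn fun e => pc n x e.1 e.2 ^ 2, T.prod_edges]
  simp only [pc_one_two hn, pc_one_last hn, pc_two_last hn, one_pow, one_mul]
  rw [← Finset.prod_div_distrib]
  refine Finset.prod_congr rfl fun k hk => ?_
  rw [Finset.mem_Icc] at hk
  have hi := T.pc_ne_zero hn hx (T.fst_mem hk.1 hk.2)
  have hj := T.pc_ne_zero hn hx (T.snd_mem hk.1 hk.2)
  simp only at hi hj
  field_simp

theorem prod_pc_par_pow (hn : 4 ≤ n) :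
    ∏ k ∈ Finset.Icc 3 (n - 1), pc n x (T.par k).1 (T.par k).2 ^
        (aA n T ((T.par k).1, k) + aA n T ((T.par k).2, k)) =
      ∏ k ∈ Finset.Icc 3 (n - 1), (pc n x (T.par k).1 k ^ (aA n T ((T.par k).1, k) - 1) *
        pc n x (T.par k).2 k ^ (aA n T ((T.par k).2, k) - 1)) := by
  have h := T.prod_edges fun e => pc n x e.1 e.2 ^ (aA n T e - 1)
  simp only [pc_one_two hn, one_pow, one_mul] at h
  rw [← h, ← T.prod_edges_fiberwise]
  refine Finset.prod_congr rfl fun e he => ?_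
  rw [aA_eq hn he, Nat.add_sub_cancel_left, ← Finset.prod_pow_eq_pow_sum]
  refine Finset.prod_congr rfl fun k hk => ?_
  rw [(Finset.mem_filter.1 hk).2]

end Integrand

/-- the square of the CHY integrand at the critical point equals
Π_{triangles} ([s_{ik}]+[s_{jk}])^{b_k+1} / ([s_{ik}]^{a_{ik}+1}·[s_{jk}]^{a_{jk}+1}). -/
theorem integrand_squared_formula (n : ℕ) (hn : 4 ≤ n) (T : TwoTree n)
    (s : ℕ × ℕ → ℂ) (hs : Generic n T s) (xh : Fin (n - 3) → ℂ)
    (hx : xh ∈ Udom n) (hc : IsCrit n (T.edges.erase (1, 2)) s xh) :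
    integrand n T xh ^ 2 =
      ∏ k ∈ Finset.Icc 3 (n - 1),
        (brk n T s ((T.par k).1, k) + brk n T s ((T.par k).2, k)) ^
            (aA n T ((T.par k).1, k) + aA n T ((T.par k).2, k) + 2)
          / (brk n T s ((T.par k).1, k) ^ (aA n T ((T.par k).1, k) + 1) *
              brk n T s ((T.par k).2, k) ^ (aA n T ((T.par k).2, k) + 1)) := by
  have hfactor : ∀ k ∈ Finset.Icc 3 (n - 1),
      (brk n T s ((T.par k).1, k) + brk n T s ((T.par k).2, k)) ^
            (aA n T ((T.par k).1, k) + aA n T ((T.par k).2, k) + 2)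
          / (brk n T s ((T.par k).1, k) ^ (aA n T ((T.par k).1, k) + 1) *
              brk n T s ((T.par k).2, k) ^ (aA n T ((T.par k).2, k) + 1)) =
        (pc n xh (T.par k).1 (T.par k).2 /
            (pc n xh (T.par k).1 k * pc n xh (T.par k).2 k)) ^ 2 *
          (pc n xh (T.par k).1 (T.par k).2 ^
              (aA n T ((T.par k).1, k) + aA n T ((T.par k).2, k)) /
            (pc n xh (T.par k).1 k ^ (aA n T ((T.par k).1, k) - 1) *
              pc n xh (T.par k).2 k ^ (aA n T ((T.par k).2, k) - 1))) := by
    intro k hk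
    rw [Finset.mem_Icc] at hk
    obtain ⟨c, hc0, hA, hB, hD⟩ := exists_brk_eq_mul hn hx hs hc hk.1 hk.2
    obtain ⟨α, hα⟩ := odd_aA hn (T.fst_mem hk.1 hk.2)
    obtain ⟨β, hβ⟩ := odd_aA hn (T.snd_mem hk.1 hk.2)
    have hi := T.pc_ne_zero hn hx (T.fst_mem hk.1 hk.2)
    have hj := T.pc_ne_zero hn hx (T.snd_mem hk.1 hk.2)
    simp only at hi hj
    have hneg : (-c * pc n xh (T.par k).2 k) ^ (2 * β + 1 + 1) =
        (c * pc n xh (T.par k).2 k) ^ (2 * β + 1 + 1) := by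
      rw [neg_mul, Even.neg_pow ⟨β + 1, by ring⟩]
    rw [hD, hA, hB, hα, hβ, hneg, Nat.add_sub_cancel, Nat.add_sub_cancel]
    simp only [mul_pow]
    field_simp
    ring
  rw [Finset.prod_congr rfl hfactor, Finset.prod_mul_distrib, Finset.prod_pow, integrand_eq hn hx,
    Finset.prod_div_distrib (f := fun k => pc n xh (T.par k).1 (T.par k).2 ^ _),
    prod_pc_par_pow hn, div_self, mul_one]
  refine Finset.prod_ne_zero_iff.2 fun k hk => ?_
  rw [Finset.mem_Icc] at hk
  exact mul_ne_zero (pow_ne_zero _ (T.pc_ne_zero hn hx (T.fst_mem hk.1 hk.2)))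
    (pow_ne_zero _ (T.pc_ne_zero hn hx (T.snd_mem hk.1 hk.2)))

end
end MinKin
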